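/- Existence of the scale factor in Case 2 with inaccessible left endpoint: Assume the Case 2 setting and condition (A2), suppose lim_{x↘l} q(y₀,x) = ∞ for some (equivalently, every) y₀ ∈ I, and suppose liminf_{y→∞} G_y(ā(y)) > 0 and liminf_{y↘l} G_y(ā(y)) > 0. Then inf_{y ∈ I} G_y(ā(y)) > 0, and there exists N₀ ∈ ℕ such that for every N ≥ N₀ and every y ∈ I there exists a unique a ∈ [0, ā(y)] with G_y(a) = 1/N; moreover this a equals sup{a' ∈ [0,∞) : G_y(a') ≤ 1/N} and is strictly positive. -/

import Mathlib

open MeasureTheory Filter Set Topology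
open scoped ENNReal

/-- The integrand `2/η(z)²`, valued in `[0,∞]` (it equals `∞` where `η` vanishes). -/
noncomputable def qIntegrand (η : ℝ → ℝ) (z : ℝ) : ℝ≥0∞ :=
  2 / ENNReal.ofReal ((η z) ^ 2)

/-- `q(y,x) = ∫_y^x ∫_y^u 2/η(z)² dz du ∈ [0,∞]`, the oriented iterated integral (nonnegative
also for `x < y`, since both orientations flip). -/
noncomputable def qfun (η : ℝ → ℝ) (y x : ℝ) : ℝ≥0∞ :=
  if y ≤ x then ∫⁻ u in Set.Ioc y x, ∫⁻ z in Set.Ioc y u, qIntegrand η z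
  else ∫⁻ u in Set.Ioc x y, ∫⁻ z in Set.Ioc u y, qIntegrand η z

/-- `G_y(a) = ∫_ℝ q(y, y + a x) μ(dx) ∈ [0,∞]`. -/
noncomputable def Gfun (η : ℝ → ℝ) (μ : Measure ℝ) (y a : ℝ) : ℝ≥0∞ :=
  ∫⁻ x, qfun η y (y + a * x) ∂μ

/-- The kernel `z ↦ (x - z)⁺ 1_{y < z} + (z - x)⁺ 1_{z ≤ y}` of the single-integral form of `q`. -/
noncomputable def qKernel (y x z : ℝ) : ℝ≥0∞ :=
  ENNReal.ofReal (if y < z then x - z else z - x)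

lemma measurable_qIntegrand {η : ℝ → ℝ} (hη : Measurable η) : Measurable (qIntegrand η) := by
  unfold qIntegrand
  fun_prop

lemma measurable_uncurry_qKernel (y : ℝ) : Measurable fun p : ℝ × ℝ => qKernel y p.1 p.2 := by
  unfold qKernel
  refine ENNReal.measurable_ofReal.comp (Measurable.ite ?_ (by fun_prop) (by fun_prop))
  exact measurableSet_lt measurable_const measurable_snd

lemma measurable_qKernel (y x : ℝ) : Measurable (qKernel y x) :=
  (measurable_uncurry_qKernel y).comp (measurable_const.prodMk measurable_id)

lemma qIntegrand_pos (η : ℝ → ℝ) (z : ℝ) : 0 < qIntegrand η z :=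
  ENNReal.div_pos two_ne_zero ENNReal.ofReal_ne_top

/-- Tonelli's theorem reduces `q` to a single integral. -/
lemma qfun_eq_lintegral_qKernel {η : ℝ → ℝ} (hη : Measurable η) (y x : ℝ) :
    qfun η y x = ∫⁻ z, qKernel y x z * qIntegrand η z := by
  have hρ := measurable_qIntegrand hη
  unfold qfun
  split_ifs with h
  · have h1 : ∀ u, (Ioc y x).indicator (fun u => ∫⁻ z in Ioc y u, qIntegrand η z) u
        = ∫⁻ z, {p : ℝ × ℝ | y < p.2 ∧ p.2 ≤ p.1 ∧ p.1 ≤ x}.indicator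
            (fun p => qIntegrand η p.2) (u, z) := by
      intro u
      by_cases hu : u ∈ Ioc y x
      · rw [indicator_of_mem hu, ← lintegral_indicator measurableSet_Ioc]
        refine lintegral_congr fun z => ?_
        simp only [indicator_apply, mem_Ioc, mem_ofPred_eq, hu.2, and_true]
      · rw [indicator_of_notMem hu]
        symm
        rw [lintegral_eq_zero_iff' (by
          refine Measurable.aemeasurable ?_
          refine Measurable.comp (Measurable.indicator (by fun_prop) ?_) (by fun_prop)
          measurability)]
        refine Eventually.of_forall fun z => indicator_of_notMem ?_ _
        rintro ⟨h1, h2, h3⟩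
        exact hu ⟨h1.trans_le h2, h3⟩
    rw [← lintegral_indicator measurableSet_Ioc, lintegral_congr h1, lintegral_lintegral_swap]
    · refine lintegral_congr fun z => ?_
      by_cases hz : y < z
      · have : ∀ u, {p : ℝ × ℝ | y < p.2 ∧ p.2 ≤ p.1 ∧ p.1 ≤ x}.indicator
            (fun p => qIntegrand η p.2) (u, z) = (Icc z x).indicator (fun _ => qIntegrand η z) u := by
          intro u
          simp only [indicator_apply, mem_Icc, mem_ofPred_eq, hz, true_and]
        rw [lintegral_congr this, lintegral_indicator_const measurableSet_Icc, Real.volume_Icc,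
          mul_comm, qKernel, if_pos hz]
      · have : ∀ u, {p : ℝ × ℝ | y < p.2 ∧ p.2 ≤ p.1 ∧ p.1 ≤ x}.indicator
            (fun p => qIntegrand η p.2) (u, z) = 0 := by
          intro u
          simp only [indicator_apply, mem_ofPred_eq, hz, false_and, if_false]
        rw [lintegral_congr this, lintegral_zero, qKernel, if_neg hz,
          ENNReal.ofReal_of_nonpos (by linarith), zero_mul]
    · refine Measurable.aemeasurable (Measurable.indicator (by fun_prop) ?_)
      measurability
  · push Not at h
    have h1 : ∀ u, (Ioc x y).indicator (fun u => ∫⁻ z in Ioc u y, qIntegrand η z) u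
        = ∫⁻ z, {p : ℝ × ℝ | p.2 ≤ y ∧ p.1 < p.2 ∧ x < p.1}.indicator
            (fun p => qIntegrand η p.2) (u, z) := by
      intro u
      by_cases hu : u ∈ Ioc x y
      · rw [indicator_of_mem hu, ← lintegral_indicator measurableSet_Ioc]
        refine lintegral_congr fun z => ?_
        simp only [indicator_apply, mem_Ioc, mem_ofPred_eq, hu.1, and_true]
        simp only [and_comm]
      · rw [indicator_of_notMem hu]
        symm
        rw [lintegral_eq_zero_iff' (by
          refine Measurable.aemeasurable ?_
          refine Measurable.comp (Measurable.indicator (by fun_prop) ?_) (by fun_prop)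
          measurability)]
        refine Eventually.of_forall fun z => indicator_of_notMem ?_ _
        rintro ⟨h1, h2, h3⟩
        exact hu ⟨h3, (h2.trans_le h1).le⟩
    rw [← lintegral_indicator measurableSet_Ioc, lintegral_congr h1, lintegral_lintegral_swap]
    · refine lintegral_congr fun z => ?_
      by_cases hz : z ≤ y
      · have : ∀ u, {p : ℝ × ℝ | p.2 ≤ y ∧ p.1 < p.2 ∧ x < p.1}.indicator
            (fun p => qIntegrand η p.2) (u, z) = (Ioo x z).indicator (fun _ => qIntegrand η z) u := by
          intro u
          simp only [indicator_apply, mem_Ioo, mem_ofPred_eq, hz, true_and, and_comm]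
        rw [lintegral_congr this, lintegral_indicator_const measurableSet_Ioo, Real.volume_Ioo,
          mul_comm, qKernel, if_neg hz.not_gt]
      · have : ∀ u, {p : ℝ × ℝ | p.2 ≤ y ∧ p.1 < p.2 ∧ x < p.1}.indicator
            (fun p => qIntegrand η p.2) (u, z) = 0 := by
          intro u
          simp only [indicator_apply, mem_ofPred_eq, hz, false_and, if_false]
        push Not at hz
        rw [lintegral_congr this, lintegral_zero, qKernel, if_pos hz,
          ENNReal.ofReal_of_nonpos (by linarith), zero_mul]
    · refine Measurable.aemeasurable (Measurable.indicator (by fun_prop) ?_)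
      measurability

lemma measurable_qfun {η : ℝ → ℝ} (hη : Measurable η) (y : ℝ) : Measurable (qfun η y) := by
  have hρ := measurable_qIntegrand hη
  rw [show qfun η y = fun x => ∫⁻ z, qKernel y x z * qIntegrand η z from
    funext (qfun_eq_lintegral_qKernel hη y)]
  exact Measurable.lintegral_prod_right'
    (f := fun p : ℝ × ℝ => qKernel y p.1 p.2 * qIntegrand η p.2)
    ((measurable_uncurry_qKernel y).mul (by fun_prop))

lemma measurable_qfun_affine {η : ℝ → ℝ} (hη : Measurable η) (y a : ℝ) :
    Measurable fun x => qfun η y (y + a * x) :=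
  (measurable_qfun hη y).comp (by fun_prop)

lemma qKernel_convex (y x x' z : ℝ) {s t : ℝ} (hs : 0 ≤ s) (ht : 0 ≤ t) (hst : s + t = 1) :
    qKernel y (s * x + t * x') z ≤
      ENNReal.ofReal s * qKernel y x z + ENNReal.ofReal t * qKernel y x' z := by
  unfold qKernel
  rw [← ENNReal.ofReal_mul hs, ← ENNReal.ofReal_mul ht]
  refine le_trans (ENNReal.ofReal_le_ofReal (le_of_eq ?_)) ENNReal.ofReal_add_le
  obtain rfl : t = 1 - s := by linarith
  split_ifs <;> ring

lemma qfun_convex {η : ℝ → ℝ} (hη : Measurable η) (y x x' : ℝ) {s t : ℝ}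
    (hs : 0 ≤ s) (ht : 0 ≤ t) (hst : s + t = 1) :
    qfun η y (s * x + t * x') ≤
      ENNReal.ofReal s * qfun η y x + ENNReal.ofReal t * qfun η y x' := by
  have hρ := measurable_qIntegrand hη
  have hk := measurable_qKernel y
  simp only [qfun_eq_lintegral_qKernel hη]
  rw [← lintegral_const_mul' _ _ ENNReal.ofReal_ne_top,
    ← lintegral_const_mul' _ _ ENNReal.ofReal_ne_top,
    ← lintegral_add_left (((hk x).fun_mul hρ).const_mul _)]
  refine lintegral_mono fun z => ?_
  refine (mul_le_mul_left (qKernel_convex y x x' z hs ht hst) _).trans (le_of_eq ?_)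
  ring

lemma Gfun_convex {η : ℝ → ℝ} (hη : Measurable η) (μ : Measure ℝ) (y a b : ℝ) {s t : ℝ}
    (hs : 0 ≤ s) (ht : 0 ≤ t) (hst : s + t = 1) :
    Gfun η μ y (s * a + t * b) ≤
      ENNReal.ofReal s * Gfun η μ y a + ENNReal.ofReal t * Gfun η μ y b := by
  unfold Gfun
  rw [← lintegral_const_mul' _ _ ENNReal.ofReal_ne_top,
    ← lintegral_const_mul' _ _ ENNReal.ofReal_ne_top,
    ← lintegral_add_left ((measurable_qfun_affine hη y a).const_mul _)]
  refine lintegral_mono fun x => ?_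
  refine le_trans (le_of_eq ?_) (qfun_convex hη y (y + a * x) (y + b * x) hs ht hst)
  congr 1
  obtain rfl : t = 1 - s := by linarith
  ring

lemma qfun_self {η : ℝ → ℝ} (y : ℝ) : qfun η y y = 0 := by
  simp [qfun]

lemma Gfun_zero {η : ℝ → ℝ} (μ : Measure ℝ) (y : ℝ) : Gfun η μ y 0 = 0 := by
  simp [Gfun, qfun_self]

lemma Gfun_mul_le {η : ℝ → ℝ} (hη : Measurable η) (μ : Measure ℝ) (y a : ℝ) {t : ℝ}
    (ht : 0 ≤ t) (ht1 : t ≤ 1) :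
    Gfun η μ y (t * a) ≤ ENNReal.ofReal t * Gfun η μ y a := by
  simpa [Gfun_zero] using
    Gfun_convex hη μ y 0 a (s := 1 - t) (t := t) (by linarith) ht (by ring)

lemma Gfun_mono {η : ℝ → ℝ} (hη : Measurable η) (μ : Measure ℝ) (y : ℝ) {a b : ℝ}
    (ha : 0 ≤ a) (hab : a ≤ b) : Gfun η μ y a ≤ Gfun η μ y b := by
  rcases hab.eq_or_lt with rfl | hlt
  · rfl
  have hb : 0 < b := ha.trans_lt hlt
  have h := Gfun_mul_le hη μ y b (t := a / b) (by positivity) (by rwa [div_le_one hb])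
  rw [div_mul_cancel₀ _ hb.ne'] at h
  refine h.trans (mul_le_of_le_one_left' ?_)
  rw [ENNReal.ofReal_le_one, div_le_one hb]
  exact hab

lemma Gfun_strictMono {η : ℝ → ℝ} (hη : Measurable η) (μ : Measure ℝ) (y : ℝ) {a b : ℝ}
    (ha : 0 ≤ a) (hab : a < b) (h0 : Gfun η μ y b ≠ 0) (htop : Gfun η μ y b ≠ ⊤) :
    Gfun η μ y a < Gfun η μ y b := by
  have hb : 0 < b := ha.trans_lt hab
  have h := Gfun_mul_le hη μ y b (t := a / b) (by positivity) (by rw [div_le_one hb]; exact hab.le)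
  rw [div_mul_cancel₀ _ hb.ne'] at h
  refine h.trans_lt ?_
  have h1 : ENNReal.ofReal (a / b) < 1 := by
    rw [ENNReal.ofReal_lt_one, div_lt_one hb]
    exact hab
  simpa using ENNReal.mul_lt_mul_left h0 htop h1

/-- Joint lower semicontinuity of `q` along filters. -/
lemma qfun_le_liminf {η : ℝ → ℝ} (hη : Measurable η) {ι : Type*} {F : Filter ι} [F.NeBot]
    [F.IsCountablyGenerated] {y x : ℝ} {ys xs : ι → ℝ}
    (hy : Tendsto ys F (𝓝 y)) (hx : Tendsto xs F (𝓝 x)) :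
    qfun η y x ≤ liminf (fun n => qfun η (ys n) (xs n)) F := by
  have hρ := measurable_qIntegrand hη
  simp only [qfun_eq_lintegral_qKernel hη]
  refine le_trans (lintegral_mono_ae ?_)
    (lintegral_liminf_le fun n => (measurable_qKernel (ys n) (xs n)).mul hρ)
  filter_upwards [compl_mem_ae_iff.2 (measure_singleton y)] with z hz
  by_cases h0 : qKernel y x z = 0
  · simp [h0]
  refine le_of_eq (Tendsto.liminf_eq ?_).symm
  refine ENNReal.Tendsto.mul_const ?_ (Or.inl h0)
  rcases lt_or_gt_of_ne (show z ≠ y from hz) with hlt | hgt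
  · have : Tendsto (fun n => ENNReal.ofReal (z - xs n)) F (𝓝 (qKernel y x z)) := by
      rw [qKernel, if_neg hlt.not_gt]
      exact ENNReal.tendsto_ofReal (hx.const_sub z)
    refine this.congr' ?_
    filter_upwards [hy.eventually_const_lt hlt] with n hn
    rw [qKernel, if_neg hn.not_gt]
  · have : Tendsto (fun n => ENNReal.ofReal (xs n - z)) F (𝓝 (qKernel y x z)) := by
      rw [qKernel, if_pos hgt]
      exact ENNReal.tendsto_ofReal (hx.sub_const z)
    refine this.congr' ?_
    filter_upwards [hy.eventually_lt_const hgt] with n hn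
    rw [qKernel, if_pos hn]

/-- Joint lower semicontinuity of `G` along filters. -/
lemma Gfun_le_liminf {η : ℝ → ℝ} (hη : Measurable η) (μ : Measure ℝ) {ι : Type*} {F : Filter ι}
    [F.NeBot] [F.IsCountablyGenerated] {y a : ℝ} {ys as : ι → ℝ}
    (hy : Tendsto ys F (𝓝 y)) (ha : Tendsto as F (𝓝 a)) :
    Gfun η μ y a ≤ liminf (fun n => Gfun η μ (ys n) (as n)) F := by
  unfold Gfun
  refine le_trans (lintegral_mono fun x => ?_)
    (lintegral_liminf_le fun n => measurable_qfun_affine hη (ys n) (as n))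
  exact qfun_le_liminf hη hy (hy.add (ha.mul_const x))

lemma qfun_pos {η : ℝ → ℝ} (hη : Measurable η) {y x : ℝ} (hxy : x ≠ y) : 0 < qfun η y x := by
  have hρ := measurable_qIntegrand hη
  rw [qfun_eq_lintegral_qKernel hη,
    lintegral_pos_iff_support ((measurable_qKernel y x).fun_mul hρ)]
  refine lt_of_lt_of_le (b := volume (Ioo (min x y) (max x y))) ?_ (measure_mono ?_)
  · rw [Real.volume_Ioo, ENNReal.ofReal_pos, sub_pos]
    exact min_lt_max.2 hxy
  · intro z hz
    refine mul_ne_zero (ne_of_gt ?_) (qIntegrand_pos η z).ne'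
    rw [qKernel, ENNReal.ofReal_pos]
    obtain ⟨h1, h2⟩ := hz
    rcases lt_or_gt_of_ne hxy with h | h
    · rw [min_eq_left h.le] at h1
      rw [max_eq_right h.le] at h2
      rw [if_neg h2.not_gt]
      linarith
    · rw [min_eq_right h.le] at h1
      rw [max_eq_left h.le] at h2
      rw [if_pos h1]
      linarith

lemma eq_dirac_of_ae_eq {μ : Measure ℝ} [IsProbabilityMeasure μ] {m : ℝ}
    (h : ∀ᵐ x ∂μ, x = m) : μ = Measure.dirac m := by
  have h1 : μ.map id = μ.map fun _ => m := Measure.map_congr h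
  simpa using h1

lemma Gfun_pos {η : ℝ → ℝ} (hη : Measurable η) {μ : Measure ℝ} [IsProbabilityMeasure μ]
    (hμ : μ ≠ Measure.dirac 0) (y : ℝ) {a : ℝ} (ha : a ≠ 0) : 0 < Gfun η μ y a := by
  rw [pos_iff_ne_zero]
  intro h0
  rw [Gfun, lintegral_eq_zero_iff (measurable_qfun_affine hη y a)] at h0
  refine hμ (eq_dirac_of_ae_eq ?_)
  filter_upwards [h0] with x hx
  by_contra hx0
  refine (qfun_pos hη (y := y) (x := y + a * x) ?_).ne' hx
  simp [ha, hx0]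

lemma neg_of_ae_ge {μ : Measure ℝ} [IsProbabilityMeasure μ]
    (hμint : Integrable (fun x => x) μ) (hμcen : ∫ x, x ∂μ = 0) (hμne : μ ≠ Measure.dirac 0)
    {c : ℝ} (hc : μ (Iio c) = 0) : c < 0 := by
  by_contra! h
  have hae : ∀ᵐ x ∂μ, 0 ≤ x := by
    filter_upwards [measure_eq_zero_iff_ae_notMem.1 hc] with x hx
    exact h.trans (not_lt.1 hx)
  exact hμne (eq_dirac_of_ae_eq ((integral_eq_zero_iff_of_nonneg_ae hae hμint).1 hμcen))

section Finiteness

variable {l : ℝ} {η : ℝ → ℝ}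

lemma setLIntegral_qIntegrand_lt_top (hηne : ∀ x ∈ Ioi l, η x ≠ 0)
    (hηloc : LocallyIntegrableOn (fun z => 1 / (η z) ^ 2) (Ioi l) volume)
    {p r : ℝ} (hp : l < p) : ∫⁻ z in Icc p r, qIntegrand η z < ⊤ := by
  have hsub : Icc p r ⊆ Ioi l := fun z hz => hp.trans_le hz.1
  have hint := (hηloc.integrableOn_compact_subset hsub isCompact_Icc).const_mul 2
  refine lt_of_le_of_lt (le_of_eq ?_) hint.lintegral_lt_top
  refine setLIntegral_congr_fun measurableSet_Icc fun z hz => ?_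
  have h := hηne z (hsub hz)
  have h2 : 0 < η z ^ 2 := by positivity
  rw [qIntegrand, mul_one_div, ENNReal.ofReal_div_of_pos h2, ENNReal.ofReal_ofNat]

lemma qfun_lt_top (hη : Measurable η) (hηne : ∀ x ∈ Ioi l, η x ≠ 0)
    (hηloc : LocallyIntegrableOn (fun z => 1 / (η z) ^ 2) (Ioi l) volume)
    {y x : ℝ} (hy : l < y) (hx : l < x) : qfun η y x < ⊤ := by
  rw [qfun_eq_lintegral_qKernel hη]
  have hfin := setLIntegral_qIntegrand_lt_top hηne hηloc (r := max x y) (lt_min hx hy)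
  refine lt_of_le_of_lt (b := ENNReal.ofReal |x - y| *
    ∫⁻ z in Icc (min x y) (max x y), qIntegrand η z) ?_
    (ENNReal.mul_lt_top ENNReal.ofReal_lt_top hfin)
  rw [← lintegral_const_mul' _ _ ENNReal.ofReal_ne_top, ← lintegral_indicator measurableSet_Icc]
  refine lintegral_mono fun z => ?_
  by_cases hz : z ∈ Icc (min x y) (max x y)
  · rw [indicator_of_mem hz]
    refine mul_le_mul_left (ENNReal.ofReal_le_ofReal ?_) _
    split_ifs with h
    · linarith [le_abs_self (x - y)]
    · linarith [neg_le_abs (x - y)]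
  · rw [indicator_of_notMem hz, nonpos_iff_eq_zero, qKernel, ENNReal.ofReal_of_nonpos, zero_mul]
    contrapose! hz
    split_ifs at hz with h
    · exact ⟨(min_le_right _ _).trans h.le, le_max_of_le_left (by linarith)⟩
    · exact ⟨min_le_of_left_le (by linarith), le_max_of_le_right (not_lt.1 h)⟩

/-- Comparison of `q` for two base points. -/
lemma qfun_le_of_base (hη : Measurable η) (y y' : ℝ) {w : ℝ} (hw : 0 ≤ w) :
    qfun η y (y + w) ≤
      ENNReal.ofReal w * (∫⁻ z in Icc y (max y y'), qIntegrand η z)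
        + qfun η y' (max y y' + w) := by
  have hρ := measurable_qIntegrand hη
  simp only [qfun_eq_lintegral_qKernel hη]
  rw [← lintegral_const_mul' _ _ ENNReal.ofReal_ne_top, ← lintegral_indicator measurableSet_Icc,
    ← lintegral_add_left ((hρ.const_mul _).indicator measurableSet_Icc)]
  refine lintegral_mono fun z => ?_
  by_cases hz : z ∈ Icc y (max y y')
  · rw [indicator_of_mem hz]
    refine le_add_right (mul_le_mul_left (ENNReal.ofReal_le_ofReal ?_) _)
    split_ifs with h
    · linarith
    · linarith [hz.1]
  · rw [indicator_of_notMem hz, zero_add]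
    refine mul_le_mul_left ?_ _
    unfold qKernel
    by_cases h : y < z
    · have h1 : max y y' < z := by
        by_contra! h1
        exact hz ⟨h.le, h1⟩
      rw [if_pos h, if_pos ((le_max_right _ _).trans_lt h1)]
      refine ENNReal.ofReal_le_ofReal ?_
      linarith [le_max_left y y']
    · rw [if_neg h, ENNReal.ofReal_of_nonpos (by linarith)]
      exact zero_le

/-- The integrability condition on the positive half-line does not depend on the base point. -/
lemma setLIntegral_qfun_Ici_lt_top (hη : Measurable η) (hηne : ∀ x ∈ Ioi l, η x ≠ 0)
    (hηloc : LocallyIntegrableOn (fun z => 1 / (η z) ^ 2) (Ioi l) volume)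
    {μ : Measure ℝ} [IsProbabilityMeasure μ] (hμint : Integrable (fun x => x) μ)
    (hA2 : ∃ y ∈ Ioi l, ∀ a : ℝ, 0 < a →
      ∫⁻ x in Ici (0 : ℝ), qfun η y (y + a * x) ∂μ < ⊤)
    {y : ℝ} (hy : l < y) {a : ℝ} (ha : 0 < a) :
    ∫⁻ x in Ici (0 : ℝ), qfun η y (y + a * x) ∂μ < ⊤ := by
  obtain ⟨y', hy', hfin⟩ := hA2
  have hy'l : l < y' := hy'
  set m := max y y' with hm
  set R := ∫⁻ z in Icc y m, qIntegrand η z with hR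
  have hRfin : R < ⊤ := setLIntegral_qIntegrand_lt_top hηne hηloc hy
  have hm' : y' ≤ m := le_max_right _ _
  have hqm : qfun η y' (2 * m - y') < ⊤ :=
    qfun_lt_top hη hηne hηloc hy'l (by linarith)
  have hbound : ∀ x ∈ Ici (0 : ℝ), qfun η y (y + a * x) ≤
      ENNReal.ofReal (a * x) * R +
        (ENNReal.ofReal (1 / 2) * qfun η y' (y' + (2 * a) * x) +
          ENNReal.ofReal (1 / 2) * qfun η y' (2 * m - y')) := by
    intro x hx
    refine (qfun_le_of_base hη y y' (mul_nonneg ha.le hx)).trans ?_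
    gcongr
    refine le_trans (le_of_eq ?_) (qfun_convex hη y' (y' + (2 * a) * x) (2 * m - y')
      (by norm_num) (by norm_num) (by norm_num))
    congr 1
    ring
  refine (setLIntegral_mono' measurableSet_Ici hbound).trans_lt ?_
  rw [lintegral_add_left (by fun_prop), lintegral_add_right _ measurable_const,
    lintegral_mul_const' _ _ hRfin.ne, lintegral_const_mul' _ _ ENNReal.ofReal_ne_top,
    setLIntegral_const]
  refine ENNReal.add_lt_top.2 ⟨ENNReal.mul_lt_top ?_ hRfin, ENNReal.add_lt_top.2
    ⟨ENNReal.mul_lt_top ENNReal.ofReal_lt_top (hfin _ (by linarith)),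
      ENNReal.mul_lt_top (ENNReal.mul_lt_top ENNReal.ofReal_lt_top hqm) (measure_lt_top _ _)⟩⟩
  exact (hμint.const_mul a).integrableOn.lintegral_lt_top

lemma qfun_anti_left {y x x' : ℝ} (hη : Measurable η) (hxx : x ≤ x') (hx : x' ≤ y) :
    qfun η y x' ≤ qfun η y x := by
  simp only [qfun_eq_lintegral_qKernel hη]
  refine lintegral_mono fun z => mul_le_mul_left ?_ _
  unfold qKernel
  split_ifs with h
  · rw [ENNReal.ofReal_of_nonpos (by linarith)]
    exact zero_le
  · exact ENNReal.ofReal_le_ofReal (by linarith)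

/-- `G_y` is finite to the left of `ā(y)`. -/
lemma Gfun_lt_top (hη : Measurable η) (hηne : ∀ x ∈ Ioi l, η x ≠ 0)
    (hηloc : LocallyIntegrableOn (fun z => 1 / (η z) ^ 2) (Ioi l) volume)
    {μ : Measure ℝ} [IsProbabilityMeasure μ] (hμint : Integrable (fun x => x) μ)
    {c : ℝ} (hc0 : c < 0) (hc : μ (Iio c) = 0)
    (hA2 : ∃ y ∈ Ioi l, ∀ a : ℝ, 0 < a →
      ∫⁻ x in Ici (0 : ℝ), qfun η y (y + a * x) ∂μ < ⊤)
    {y : ℝ} (hy : l < y) {a : ℝ} (ha : 0 < a) (hac : a < (l - y) / c) :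
    Gfun η μ y a < ⊤ := by
  rw [Gfun, ← lintegral_add_compl _ (measurableSet_Ici (a := (0 : ℝ)))]
  refine ENNReal.add_lt_top.2
    ⟨setLIntegral_qfun_Ici_lt_top hη hηne hηloc hμint hA2 hy ha, ?_⟩
  have hpos : l < y + a * c := by
    rw [lt_div_iff_of_neg hc0] at hac
    linarith
  refine lt_of_le_of_lt (b := ∫⁻ _ in (Ici (0 : ℝ))ᶜ, qfun η y (y + a * c) ∂μ) ?_ ?_
  · refine setLIntegral_mono_ae' measurableSet_Ici.compl ?_
    filter_upwards [measure_eq_zero_iff_ae_notMem.1 hc] with x hx hx0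
    have h1 : c ≤ x := not_lt.1 hx
    have h2 : x < 0 := not_le.1 hx0
    refine qfun_anti_left hη ?_ ?_
    · linarith [mul_le_mul_of_nonneg_left h1 ha.le]
    · linarith [mul_neg_of_pos_of_neg ha h2]
  · rw [setLIntegral_const]
    exact ENNReal.mul_lt_top (qfun_lt_top hη hηne hηloc hy hpos) (measure_lt_top _ _)

end Finiteness

/-- A lower semicontinuous positive function on `(l, ∞)` with positive lower limits at both ends
is bounded away from zero. -/
lemma exists_pos_le_of_liminf_pos {l : ℝ} {f : ℝ → ℝ≥0∞} (hpos : ∀ y ∈ Ioi l, 0 < f y)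
    (hlsc : LowerSemicontinuous f)
    (htop : 0 < liminf f atTop) (hl : 0 < liminf f (𝓝[>] l)) :
    ∃ ε : ℝ≥0∞, 0 < ε ∧ ∀ y ∈ Ioi l, ε ≤ f y := by
  obtain ⟨ε₁, hε₁, h1⟩ := exists_between htop
  obtain ⟨ε₂, hε₂, h2⟩ := exists_between hl
  obtain ⟨M, hM⟩ := eventually_atTop.1 (eventually_lt_of_lt_liminf h1)
  obtain ⟨p, hp, hpl⟩ := mem_nhdsGT_iff_exists_Ioo_subset.1 (eventually_lt_of_lt_liminf h2)
  have hmid : ∃ ε₃ : ℝ≥0∞, 0 < ε₃ ∧ ∀ y ∈ Icc p M, ε₃ ≤ f y := by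
    rcases (Icc p M).eq_empty_or_nonempty with he | hne
    · exact ⟨1, one_pos, by simp [he]⟩
    · obtain ⟨m, hm, hmin⟩ :=
        (hlsc.lowerSemicontinuousOn _).exists_isMinOn hne isCompact_Icc
      exact ⟨f m, hpos m (lt_of_lt_of_le hp hm.1), fun y hy => hmin hy⟩
  obtain ⟨ε₃, hε₃, h3⟩ := hmid
  refine ⟨min ε₁ (min ε₂ ε₃), lt_min hε₁ (lt_min hε₂ hε₃), fun y hy => ?_⟩
  rcases lt_or_ge y p with hyp | hyp
  · exact (min_le_right _ _).trans ((min_le_left _ _).trans (hpl ⟨hy, hyp⟩).le)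
  rcases le_total M y with hyM | hyM
  · exact (min_le_left _ _).trans (hM y hyM).le
  · exact (min_le_right _ _).trans ((min_le_right _ _).trans (h3 y ⟨hyp, hyM⟩))

/-- Level sets of `G_y`: a level `δ` strictly below `G_y(b)` is attained exactly once. -/
lemma exists_unique_level {η : ℝ → ℝ} (hη : Measurable η) (μ : Measure ℝ) (y : ℝ) {b : ℝ}
    {δ : ℝ≥0∞} (hδb : δ < Gfun η μ y b) (hδ0 : δ ≠ 0) (hδtop : δ ≠ ⊤) (hb : 0 ≤ b)
    (hfin : ∀ a, 0 < a → a < b → Gfun η μ y a < ⊤) :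
    ∃ a : ℝ, a ∈ Icc 0 b ∧ Gfun η μ y a = δ ∧
      (∀ a' ∈ Icc 0 b, Gfun η μ y a' = δ → a' = a) ∧
      a = sSup {a' : ℝ | 0 ≤ a' ∧ Gfun η μ y a' ≤ δ} ∧ 0 < a := by
  set S := {a' : ℝ | 0 ≤ a' ∧ Gfun η μ y a' ≤ δ} with hS
  have hS0 : (0 : ℝ) ∈ S := ⟨le_rfl, by simp [Gfun_zero]⟩
  have hSb : ∀ a' ∈ S, a' ≤ b := by
    intro a' ha'
    by_contra! h
    exact (hδb.trans_le (Gfun_mono hη μ y hb h.le)).not_ge ha'.2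
  have hbdd : BddAbove S := ⟨b, hSb⟩
  have hs0 : 0 ≤ sSup S := le_csSup hbdd hS0
  have hsb : sSup S ≤ b := csSup_le ⟨0, hS0⟩ hSb
  have hle : Gfun η μ y (sSup S) ≤ δ := by
    obtain ⟨u, -, hu, huS⟩ := exists_seq_tendsto_sSup ⟨0, hS0⟩ hbdd
    refine (Gfun_le_liminf hη μ (tendsto_const_nhds (x := y)) hu).trans ?_
    exact liminf_le_of_le (by isBoundedDefault) fun d hd => by
      obtain ⟨k, hk⟩ := hd.exists
      exact hk.trans (huS k).2
  have heq : Gfun η μ y (sSup S) = δ := by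
    refine hle.eq_of_not_lt fun hlt => ?_
    have hsb' : sSup S < b := hsb.lt_of_ne fun h => (h ▸ hδb).not_ge hle
    obtain ⟨b', hb1, hb2⟩ := exists_between hsb'
    have hfin' := hfin b' (hs0.trans_lt hb1) hb2
    have hlim : Tendsto (fun s : ℝ => Gfun η μ y (sSup S) + ENNReal.ofReal s * Gfun η μ y b')
        (𝓝[>] 0) (𝓝 (Gfun η μ y (sSup S))) := by
      have h1 : Tendsto (fun s : ℝ => ENNReal.ofReal s) (𝓝[>] 0) (𝓝 0) := by
        simpa using (ENNReal.continuous_ofReal.tendsto (0 : ℝ)).mono_left nhdsWithin_le_nhds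
      simpa using tendsto_const_nhds.add (ENNReal.Tendsto.mul_const h1 (Or.inr hfin'.ne))
    obtain ⟨s, hs, hs1⟩ := ((hlim.eventually_lt_const hlt).and
      (Ioo_mem_nhdsGT (zero_lt_one' ℝ))).exists
    have hmem : (1 - s) * sSup S + s * b' ∈ S := by
      refine ⟨by nlinarith [hs1.1, hs1.2], ?_⟩
      refine (Gfun_convex hη μ y (sSup S) b' (by linarith [hs1.2]) hs1.1.le (by ring)).trans
        (le_trans ?_ hs.le)
      gcongr
      refine mul_le_of_le_one_left' ?_
      rw [ENNReal.ofReal_le_one]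
      linarith [hs1.1]
    have := le_csSup hbdd hmem
    nlinarith [hs1.1]
  have hspos : 0 < sSup S := hs0.lt_of_ne fun h => hδ0 (by rw [← heq, ← h, Gfun_zero])
  refine ⟨sSup S, ⟨hs0, hsb⟩, heq, fun a' ha' h => ?_, rfl, hspos⟩
  refine (le_csSup hbdd ⟨ha'.1, h.le⟩).eq_of_not_lt fun hlt => ?_
  have := Gfun_strictMono hη μ y ha'.1 hlt (heq ▸ hδ0) (heq ▸ hδtop)
  exact this.ne (h.trans heq.symm)

/-- **Existence of the scale factor in Case 2 with inaccessible left endpoint**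
(`I = (l,∞)`, condition (A2), `q(y₀,x) → ∞` as `x ↘ l` for some `y₀ ∈ I`,
`liminf_{y→∞} G_y(ā(y)) > 0` and `liminf_{y↘l} G_y(ā(y)) > 0`).
Then `inf_{y ∈ I} G_y(ā(y)) > 0` and there is `N₀ ∈ ℕ` such that for every `N ≥ N₀` and
`y ∈ I` there is a unique `a ∈ [0, ā(y)]` with `G_y(a) = 1/N`; moreover this `a` equals
`sup {a' ≥ 0 : G_y(a') ≤ 1/N}` and is strictly positive.
Here `c = inf supp μ` and `ā(y) = (l−y)/c`. -/
theorem exists_scale_factor_case2_inaccessible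
    (l : ℝ) (η : ℝ → ℝ) (hηmeas : Measurable η)
    (hηne : ∀ x ∈ Set.Ioi l, η x ≠ 0) (hηzero : ∀ x ∉ Set.Ioi l, η x = 0)
    (hηloc : LocallyIntegrableOn (fun z => 1 / (η z) ^ 2) (Set.Ioi l) volume)
    (μ : Measure ℝ) [IsProbabilityMeasure μ]
    (hμint : Integrable (fun x => x) μ) (hμcen : ∫ x, x ∂μ = 0)
    (hμne : μ ≠ Measure.dirac 0)
    (c : ℝ) (hc_null : μ (Set.Iio c) = 0) (hc_inf : ∀ ε > (0 : ℝ), 0 < μ (Set.Iio (c + ε)))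
    (hA2 : ∃ y ∈ Set.Ioi l, ∀ a : ℝ, 0 < a →
      ∫⁻ x in Set.Ici (0 : ℝ), qfun η y (y + a * x) ∂μ < ⊤)
    (hql : ∃ y₀ ∈ Set.Ioi l, Tendsto (fun x => qfun η y₀ x) (𝓝[>] l) (𝓝 ⊤))
    (hliminf_top : 0 < Filter.liminf (fun y => Gfun η μ y ((l - y) / c)) atTop)
    (hliminf_l : 0 < Filter.liminf (fun y => Gfun η μ y ((l - y) / c)) (𝓝[>] l)) :
    (∃ ε : ℝ≥0∞, 0 < ε ∧ ∀ y ∈ Set.Ioi l, ε ≤ Gfun η μ y ((l - y) / c)) ∧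
    ∃ N₀ : ℕ, ∀ N : ℕ, N₀ ≤ N → ∀ y ∈ Set.Ioi l,
      ∃ a : ℝ, a ∈ Set.Icc 0 ((l - y) / c) ∧ Gfun η μ y a = 1 / (N : ℝ≥0∞) ∧
        (∀ a' ∈ Set.Icc 0 ((l - y) / c), Gfun η μ y a' = 1 / (N : ℝ≥0∞) → a' = a) ∧
        a = sSup {a' : ℝ | 0 ≤ a' ∧ Gfun η μ y a' ≤ 1 / (N : ℝ≥0∞)} ∧
        0 < a := by
  have hc0 : c < 0 := neg_of_ae_ge hμint hμcen hμne hc_null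
  have hinf : ∃ ε : ℝ≥0∞, 0 < ε ∧ ∀ y ∈ Set.Ioi l, ε ≤ Gfun η μ y ((l - y) / c) := by
    refine exists_pos_le_of_liminf_pos (fun y hy => ?_) ?_
      hliminf_top hliminf_l
    · exact Gfun_pos hηmeas hμne y (div_ne_zero (sub_ne_zero.2 (ne_of_lt hy)) hc0.ne)
    · exact lowerSemicontinuous_iff_le_liminf.2 fun y =>
        Gfun_le_liminf hηmeas μ tendsto_id ((tendsto_id.const_sub l).div_const c)
  refine ⟨hinf, ?_⟩
  obtain ⟨ε, hε, hle⟩ := hinf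
  obtain ⟨n, hn⟩ := ENNReal.exists_inv_nat_lt hε.ne'
  refine ⟨n + 1, fun N hN y hy => ?_⟩
  have hδ : 1 / (N : ℝ≥0∞) < ε := by
    rw [one_div]
    refine lt_of_le_of_lt ?_ hn
    exact ENNReal.inv_le_inv.2 (by exact_mod_cast (Nat.le_succ n).trans hN)
  have hδ0 : 1 / (N : ℝ≥0∞) ≠ 0 := by simp
  have hδtop : 1 / (N : ℝ≥0∞) ≠ ⊤ := (hδ.trans_le le_top).ne
  exact exists_unique_level hηmeas μ y (hδ.trans_le (hle y hy)) hδ0 hδtop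
    (div_nonneg_of_nonpos (sub_nonpos.2 (le_of_lt hy)) hc0.le)
    fun a ha hac => Gfun_lt_top hηmeas hηne hηloc hμint hc0 hc_null hA2 hy ha hac
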